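/- arXiv:2508.07889 — 8 statements merged into one kernel-verified Lean document; each statement's English description precedes it below -/
import Mathlib

section
/- Let 𝔤 be a 2-step nilpotent real Lie algebra (𝔤¹ ⊆ 𝔷) with a complex structure J. Then the subspace J𝔤¹ = {JX : X ∈ 𝔤¹} is an abelian ideal of 𝔤, i.e. [J𝔤¹, 𝔤] ⊆ J𝔤¹ and [J𝔤¹, J𝔤¹] = 0. -/
noncomputable section

/-- The commutator ideal `𝔤¹ = [𝔤,𝔤]` of a real Lie algebra, as a submodule:
the span of all brackets. -/
def commIdeal (L : Type*) [LieRing L] [LieAlgebra ℝ L] : Submodule ℝ L :=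
  Submodule.span ℝ {z : L | ∃ x y : L, ⁅x, y⁆ = z}

/-- The center `𝔷` of a real Lie algebra, as a submodule. -/
def centerSub (L : Type*) [LieRing L] [LieAlgebra ℝ L] : Submodule ℝ L where
  carrier := {z : L | ∀ x : L, ⁅z, x⁆ = 0}
  add_mem' := by
    intro a b ha hb x
    rw [add_lie, ha x, hb x, add_zero]
  zero_mem' := fun x => zero_lie x
  smul_mem' := by
    intro c a ha x
    rw [smul_lie, ha x, smul_zero]

/-- The Nijenhuis tensor of an endomorphism `J` of a Lie algebra. -/
def nijenhuis {L : Type*} [LieRing L] [LieAlgebra ℝ L] (J : Module.End ℝ L) (X Y : L) : L :=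
  ⁅X, Y⁆ + J (⁅J X, Y⁆ + ⁅X, J Y⁆) - ⁅J X, J Y⁆

/-- A complex structure on a real Lie algebra: `J² = -id` and `N_J ≡ 0`. -/
structure IsComplexStructure {L : Type*} [LieRing L] [LieAlgebra ℝ L]
    (J : Module.End ℝ L) : Prop where
  sq : ∀ X : L, J (J X) = -X
  integrable : ∀ X Y : L, nijenhuis J X Y = 0

/-- A hypercomplex structure `(J₁,J₂,J₃)` on a real Lie algebra. -/
structure IsHypercomplex {L : Type*} [LieRing L] [LieAlgebra ℝ L]
    (J1 J2 J3 : Module.End ℝ L) : Prop where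
  c1 : IsComplexStructure J1
  c2 : IsComplexStructure J2
  c3 : IsComplexStructure J3
  q12 : ∀ X : L, J1 (J2 X) = J3 X
  q21 : ∀ X : L, J2 (J1 X) = -J3 X

/-- The Obata connection `∇_X Y` of a hypercomplex Lie algebra. -/
def obata {L : Type*} [LieRing L] [LieAlgebra ℝ L] (J1 J2 J3 : Module.End ℝ L)
    (X Y : L) : L :=
  (1/2 : ℝ) • (⁅X, Y⁆ + J1 ⁅J1 X, Y⁆ - J2 ⁅X, J2 Y⁆ + J3 ⁅J1 X, J2 Y⁆)

/-- The curvature tensor `R(X,Y)Z` of the Obata connection. -/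
def obataCurv {L : Type*} [LieRing L] [LieAlgebra ℝ L] (J1 J2 J3 : Module.End ℝ L)
    (X Y Z : L) : L :=
  obata J1 J2 J3 X (obata J1 J2 J3 Y Z) - obata J1 J2 J3 Y (obata J1 J2 J3 X Z)
    - obata J1 J2 J3 ⁅X, Y⁆ Z

/-- If `X` is central and `J` is integrable, then `ad (J X)` is complex linear. -/
lemma IsComplexStructure.lie_map_map_of_mem_centerSub {L : Type*} [LieRing L] [LieAlgebra ℝ L]
    {J : Module.End ℝ L} (hJ : IsComplexStructure J) {X : L} (hX : X ∈ centerSub L) (Y : L) :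
    ⁅J X, J Y⁆ = J ⁅J X, Y⁆ := by
  have hc : ∀ Z : L, ⁅X, Z⁆ = 0 := hX
  have h := hJ.integrable X Y
  rw [nijenhuis, hc, hc, zero_add, add_zero, sub_eq_zero] at h
  exact h.symm

/-- Let `𝔤` be a 2-step nilpotent real Lie algebra with a complex structure `J`.
Then `J𝔤¹` is an abelian ideal of `𝔤`: `[J𝔤¹, 𝔤] ⊆ J𝔤¹` and `[J𝔤¹, J𝔤¹] = 0`. -/
theorem stmt_1 {L : Type*} [LieRing L] [LieAlgebra ℝ L] [FiniteDimensional ℝ L]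
    (J : Module.End ℝ L) (hJ : IsComplexStructure J)
    (h2 : commIdeal L ≤ centerSub L) :
    (∀ a ∈ (commIdeal L).map J, ∀ x : L, ⁅a, x⁆ ∈ (commIdeal L).map J) ∧
    (∀ a ∈ (commIdeal L).map J, ∀ b ∈ (commIdeal L).map J, ⁅a, b⁆ = 0) := by
  constructor
  · rintro _ ⟨X, hX, rfl⟩ x
    refine ⟨-⁅J X, J x⁆, neg_mem (Submodule.subset_span ⟨_, _, rfl⟩), ?_⟩
    rw [hJ.lie_map_map_of_mem_centerSub (h2 hX), map_neg, hJ.sq, neg_neg]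
  · rintro _ ⟨X, hX, rfl⟩ _ ⟨Y, hY, rfl⟩
    have hc : ∀ Z : L, ⁅Y, Z⁆ = 0 := h2 hY
    rw [hJ.lie_map_map_of_mem_centerSub (h2 hX), ← lie_skew, hc, neg_zero, map_zero]
end
end

section
/- Let (𝔤, J₁, J₂, J₃) be a 2-step nilpotent hypercomplex real Lie algebra. Then for all X, Y, Z ∈ 𝔤 the curvature tensor of the Obata connection satisfies (with (α,β,γ) = (1,2,3)): 4R(X,Y)Z = −J₂[X,J₂[Y,Z]] + J₃[J₁X,J₂[Y,Z]] − J₃[X,J₂[J₁Y,Z]] − J₂[J₁X,J₂[J₁Y,Z]] − [X,J₂[Y,J₂Z]] − J₁[J₁X,J₂[Y,J₂Z]] + J₁[X,J₂[J₁Y,J₂Z]] − [J₁X,J₂[J₁Y,J₂Z]] + J₂[Y,J₂[X,Z]] − J₃[J₁Y,J₂[X,Z]] + J₃[Y,J₂[J₁X,Z]] + J₂[J₁Y,J₂[J₁X,Z]] + [Y,J₂[X,J₂Z]] + J₁[J₁Y,J₂[X,J₂Z]] − J₁[Y,J₂[J₁X,J₂Z]] + [J₁Y,J₂[J₁X,J₂Z]]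 − 2[J₂[X,Y],J₂Z] + 2J₃[J₂[X,Y],J₁Z]. -/
noncomputable section

section

variable {L : Type*} [LieRing L] [LieAlgebra ℝ L]

theorem lie_mem_commIdeal (X Y : L) : ⁅X, Y⁆ ∈ commIdeal L :=
  Submodule.subset_span ⟨X, Y, rfl⟩

/-- On a central argument, integrability of `J` says that `J` commutes with `ad (J A)`. -/
theorem IsComplexStructure.map_lie_of_central {J : Module.End ℝ L} (hJ : IsComplexStructure J)
    {A : L} (hA : A ∈ centerSub L) (W : L) : J ⁅J A, W⁆ = ⁅J A, J W⁆ := by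
  have hA' : ∀ x : L, ⁅A, x⁆ = 0 := hA
  have h := hJ.integrable A W
  simp only [nijenhuis, hA', zero_add, add_zero] at h
  exact sub_eq_zero.mp h

namespace IsHypercomplex

variable {J1 J2 J3 : Module.End ℝ L}

theorem q13 (hH : IsHypercomplex J1 J2 J3) (X : L) : J1 (J3 X) = -J2 X := by
  rw [← hH.q12, hH.c1.sq]

theorem q31 (hH : IsHypercomplex J1 J2 J3) (X : L) : J3 (J1 X) = J2 X := by
  rw [← hH.q12, hH.q21, map_neg, hH.q13, neg_neg]

theorem q23 (hH : IsHypercomplex J1 J2 J3) (X : L) : J2 (J3 X) = J1 X := by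
  rw [← neg_eq_iff_eq_neg.mpr (hH.q21 X), map_neg, hH.c2.sq, neg_neg]

/-- The Obata connection in the direction of a central vector. -/
theorem obata_of_central (hH : IsHypercomplex J1 J2 J3) {A : L} (hA : A ∈ centerSub L) (Z : L) :
    (2 : ℝ) • obata J1 J2 J3 A Z = ⁅J2 A, J2 Z⁆ - J3 ⁅J2 A, J1 Z⁆ := by
  have hA' : ∀ x : L, ⁅A, x⁆ = 0 := hA
  have h12 := congrArg J1 (hH.c2.integrable (J1 A) Z)
  have h21 := congrArg J2 (hH.c1.integrable (J2 A) Z)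
  have h3 := congrArg J1 (hH.c3.map_lie_of_central hA (J1 Z))
  have h2 := hH.c2.map_lie_of_central hA Z
  simp only [nijenhuis, map_add, map_sub, map_neg, map_zero, neg_lie, hH.q12, hH.q21, hH.q13,
    hH.q31] at h12 h21 h3
  simp only [obata, hA', map_zero]
  linear_combination (norm := module) h12 - h21 + h3 + h2

/-- The second covariant derivative of the Obata connection when brackets are central. -/
theorem obata_obata (hH : IsHypercomplex J1 J2 J3) (h2 : commIdeal L ≤ centerSub L) (X Y Z : L) :
    (4 : ℝ) • obata J1 J2 J3 X (obata J1 J2 J3 Y Z) =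
      -(J2 ⁅X, J2 ⁅Y, Z⁆⁆) + J3 ⁅J1 X, J2 ⁅Y, Z⁆⁆
      - J3 ⁅X, J2 ⁅J1 Y, Z⁆⁆ - J2 ⁅J1 X, J2 ⁅J1 Y, Z⁆⁆
      - ⁅X, J2 ⁅Y, J2 Z⁆⁆ - J1 ⁅J1 X, J2 ⁅Y, J2 Z⁆⁆
      + J1 ⁅X, J2 ⁅J1 Y, J2 Z⁆⁆ - ⁅J1 X, J2 ⁅J1 Y, J2 Z⁆⁆ := by
  have hc (W U V : L) : ⁅W, ⁅U, V⁆⁆ = 0 := by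
    rw [← lie_skew, h2 (lie_mem_commIdeal U V) W, neg_zero]
  have hb := hH.c1.integrable X ⁅J1 Y, Z⁆
  have hb' := congrArg J3 (hH.c1.integrable X (J2 ⁅J1 Y, Z⁆))
  have hd := congrArg J3 (hH.c1.integrable X ⁅J1 Y, J2 Z⁆)
  have hd' := congrArg J1 (hH.c1.integrable X (J2 ⁅J1 Y, J2 Z⁆))
  simp only [nijenhuis, hc, map_add, map_sub, map_zero, hH.q12, hH.q31,
    hH.c1.sq] at hb hb' hd hd'
  have hb1 := congrArg J1 hb
  simp only [map_add, map_sub, map_zero, hH.c1.sq] at hb1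
  simp only [obata, map_smul, lie_smul, lie_add, lie_sub, map_add, map_sub, hc, map_zero,
    hH.q21, hH.q23, hH.c2.sq, lie_neg, map_neg]
  linear_combination (norm := module) hb' - hd' - hb1 - hd

end IsHypercomplex

end

/-- Explicit formula for the curvature tensor of the Obata connection of a
2-step nilpotent hypercomplex Lie algebra, with `(α,β,γ) = (1,2,3)`. -/
theorem stmt_2 {L : Type*} [LieRing L] [LieAlgebra ℝ L] [FiniteDimensional ℝ L]
    (J1 J2 J3 : Module.End ℝ L) (hH : IsHypercomplex J1 J2 J3)
    (h2 : commIdeal L ≤ centerSub L) :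
    ∀ X Y Z : L, (4 : ℝ) • obataCurv J1 J2 J3 X Y Z =
      -(J2 ⁅X, J2 ⁅Y, Z⁆⁆) + J3 ⁅J1 X, J2 ⁅Y, Z⁆⁆
      - J3 ⁅X, J2 ⁅J1 Y, Z⁆⁆ - J2 ⁅J1 X, J2 ⁅J1 Y, Z⁆⁆
      - ⁅X, J2 ⁅Y, J2 Z⁆⁆ - J1 ⁅J1 X, J2 ⁅Y, J2 Z⁆⁆
      + J1 ⁅X, J2 ⁅J1 Y, J2 Z⁆⁆ - ⁅J1 X, J2 ⁅J1 Y, J2 Z⁆⁆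
      + J2 ⁅Y, J2 ⁅X, Z⁆⁆ - J3 ⁅J1 Y, J2 ⁅X, Z⁆⁆
      + J3 ⁅Y, J2 ⁅J1 X, Z⁆⁆ + J2 ⁅J1 Y, J2 ⁅J1 X, Z⁆⁆
      + ⁅Y, J2 ⁅X, J2 Z⁆⁆ + J1 ⁅J1 Y, J2 ⁅X, J2 Z⁆⁆
      - J1 ⁅Y, J2 ⁅J1 X, J2 Z⁆⁆ + ⁅J1 Y, J2 ⁅J1 X, J2 Z⁆⁆
      - (2 : ℝ) • ⁅J2 ⁅X, Y⁆, J2 Z⁆ + (2 : ℝ) • J3 ⁅J2 ⁅X, Y⁆, J1 Z⁆ := by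
  intro X Y Z
  have hA := hH.obata_of_central (h2 (lie_mem_commIdeal X Y)) Z
  have hXY := hH.obata_obata h2 X Y Z
  have hYX := hH.obata_obata h2 Y X Z
  rw [obataCurv]
  linear_combination (norm := module) hXY - hYX - (2 : ℝ) • hA
end
end

section
/- Let (𝔤, J₁, J₂, J₃) be a 2-step nilpotent hypercomplex real Lie algebra. If for some index β ∈ {1,2,3} one has J_β𝔤¹ ⊆ 𝔷 (equivalently, the complex structure J_β is 2-step nilpotent), then the Obata connection of (𝔤, J₁, J₂, J₃) is flat: R(X,Y)Z = 0 for all X, Y, Z ∈ 𝔤. -/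
noncomputable section

namespace IsHypercomplex

variable {L : Type*} [LieRing L] [LieAlgebra ℝ L] {J1 J2 J3 : Module.End ℝ L}

lemma J1_J3 (h : IsHypercomplex J1 J2 J3) (X : L) : J1 (J3 X) = -J2 X := by
  rw [← h.q12, h.c1.sq]

lemma J3_J1 (h : IsHypercomplex J1 J2 J3) (X : L) : J3 (J1 X) = J2 X := by
  rw [← h.q12, h.q21, map_neg, h.J1_J3, neg_neg]

lemma J2_J3 (h : IsHypercomplex J1 J2 J3) (X : L) : J2 (J3 X) = J1 X := by
  rw [← neg_eq_iff_eq_neg.mpr (h.q21 X), map_neg, h.c2.sq, neg_neg]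

lemma J3_J2 (h : IsHypercomplex J1 J2 J3) (X : L) : J3 (J2 X) = -J1 X := by
  rw [← h.q12, h.c2.sq, map_neg]

/-- The Obata connection preserves `J₁`. -/
lemma obata_J1 (h : IsHypercomplex J1 J2 J3) (X Y : L) :
    obata J1 J2 J3 X (J1 Y) = J1 (obata J1 J2 J3 X Y) := by
  have e1 := congrArg J1 (h.c1.integrable X Y)
  have e2 := congrArg J3 (h.c1.integrable X (J2 Y))
  simp only [nijenhuis, map_add, map_sub, map_zero, h.c1.sq, h.q12,
    h.J3_J1] at e1 e2
  simp only [obata, map_smul, map_add, map_sub, h.c1.sq, h.q12, h.q21, h.J1_J3, lie_neg, map_neg]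
  congr 1
  linear_combination (norm := module) e2 - e1

/-- The Obata connection preserves `J₂`. -/
lemma obata_J2 (h : IsHypercomplex J1 J2 J3) (X Y : L) :
    obata J1 J2 J3 X (J2 Y) = J2 (obata J1 J2 J3 X Y) := by
  simp only [obata, map_smul, map_add, map_sub, h.c2.sq, h.q21, h.J2_J3, lie_neg, map_neg]
  congr 1
  abel

/-- The Obata connection preserves `J₃`. -/
lemma obata_J3 (h : IsHypercomplex J1 J2 J3) (X Y : L) :
    obata J1 J2 J3 X (J3 Y) = J3 (obata J1 J2 J3 X Y) := by
  rw [← h.q12, h.obata_J1, h.obata_J2, h.q12]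

end IsHypercomplex

section Central

variable {L : Type*} [LieRing L] [LieAlgebra ℝ L]

/-- If `w` is central, then bracketing with `J w` commutes with the complex structure `J`. -/
lemma IsComplexStructure.lie_apply_of_central {J : Module.End ℝ L} (h : IsComplexStructure J)
    {w : L} (hw : w ∈ centerSub L) (Y : L) : ⁅J w, J Y⁆ = J ⁅J w, Y⁆ := by
  have e := h.integrable w Y
  rw [nijenhuis, hw Y, hw (J Y), add_zero, zero_add, sub_eq_zero] at e
  exact e.symm

lemma lie_eq_zero_of_central {w : L} (hw : w ∈ centerSub L) (X : L) : ⁅X, w⁆ = 0 := by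
  rw [← lie_skew, hw X, neg_zero]

variable {J1 J2 J3 Jb : Module.End ℝ L}

/-- If `w` and `J_β w` are central, then `[J₁ w, ·]` is `J₂`-linear. -/
lemma IsHypercomplex.lie_J1_J2 (h : IsHypercomplex J1 J2 J3)
    (hb : Jb = J1 ∨ Jb = J2 ∨ Jb = J3) {w : L} (hw : w ∈ centerSub L)
    (hJw : Jb w ∈ centerSub L) (Y : L) : ⁅J1 w, J2 Y⁆ = J2 ⁅J1 w, Y⁆ := by
  rcases hb with rfl | rfl | rfl
  · rw [hJw, hJw, map_zero]
  · have e1 := h.c1.lie_apply_of_central hw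
    have e3 := h.c3.lie_apply_of_central hJw
    simp only [h.J3_J2, neg_lie, map_neg, neg_inj] at e3
    rw [← h.J3_J1, e3, e1, h.J3_J1]
  · have e := h.c2.lie_apply_of_central hJw Y
    rwa [h.J2_J3] at e

/-- If `w` and `J_β w` are central, then `[J₂ w, ·]` is `J₁`-linear. -/
lemma IsHypercomplex.lie_J2_J1 (h : IsHypercomplex J1 J2 J3)
    (hb : Jb = J1 ∨ Jb = J2 ∨ Jb = J3) {w : L} (hw : w ∈ centerSub L)
    (hJw : Jb w ∈ centerSub L) (Y : L) : ⁅J2 w, J1 Y⁆ = J1 ⁅J2 w, Y⁆ := by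
  rcases hb with rfl | rfl | rfl
  · have e2 := h.c2.lie_apply_of_central hw
    have e3 := h.c3.lie_apply_of_central hJw
    simp only [h.J3_J1] at e3
    rw [← h.J2_J3, e2, e3, h.J2_J3]
  · rw [hJw, hJw, map_zero]
  · have e := h.c1.lie_apply_of_central hJw Y
    simpa only [h.J1_J3, neg_lie, map_neg, neg_inj] using e

lemma IsHypercomplex.obata_left_eq_zero (h : IsHypercomplex J1 J2 J3)
    (hb : Jb = J1 ∨ Jb = J2 ∨ Jb = J3) {w : L} (hw : w ∈ centerSub L)
    (hJw : Jb w ∈ centerSub L) (Y : L) : obata J1 J2 J3 w Y = 0 := by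
  rw [obata, hw Y, hw (J2 Y), h.lie_J1_J2 hb hw hJw, h.J3_J2]
  simp

lemma IsHypercomplex.obata_right_eq_zero (h : IsHypercomplex J1 J2 J3)
    (hb : Jb = J1 ∨ Jb = J2 ∨ Jb = J3) {w : L} (hw : w ∈ centerSub L)
    (hJw : Jb w ∈ centerSub L) (X : L) : obata J1 J2 J3 X w = 0 := by
  rw [obata, lie_eq_zero_of_central hw, lie_eq_zero_of_central hw, ← lie_skew X (J2 w),
    ← lie_skew (J1 X) (J2 w), h.lie_J2_J1 hb hw hJw, map_neg J3, h.J3_J1,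
    map_neg J2, map_zero]
  module

lemma obata_add (X Y Z : L) :
    obata J1 J2 J3 X (Y + Z) = obata J1 J2 J3 X Y + obata J1 J2 J3 X Z := by
  simp only [obata, map_add, lie_add, ← smul_add]
  congr 1
  abel

lemma obata_smul (c : ℝ) (X Y : L) :
    obata J1 J2 J3 X (c • Y) = c • obata J1 J2 J3 X Y := by
  simp only [obata, map_smul, lie_smul, smul_comm _ c, ← smul_add, ← smul_sub]

lemma obata_neg (X Y : L) : obata J1 J2 J3 X (-Y) = -obata J1 J2 J3 X Y := by
  simpa using obata_smul (J1 := J1) (J2 := J2) (J3 := J3) (-1) X Y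

end Central

/-- If in a 2-step nilpotent hypercomplex Lie algebra one of the three complex
structures `J_β` satisfies `J_β 𝔤¹ ⊆ 𝔷` (i.e. `J_β` is 2-step nilpotent), then the Obata
connection is flat. -/
theorem stmt_3 {L : Type*} [LieRing L] [LieAlgebra ℝ L] [FiniteDimensional ℝ L]
    (J1 J2 J3 : Module.End ℝ L) (hH : IsHypercomplex J1 J2 J3)
    (h2 : commIdeal L ≤ centerSub L)
    (Jb : Module.End ℝ L) (hb : Jb = J1 ∨ Jb = J2 ∨ Jb = J3)
    (hnil : (commIdeal L).map Jb ≤ centerSub L) :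
    ∀ X Y Z : L, obataCurv J1 J2 J3 X Y Z = 0 := by
  have mem : ∀ a b : L, ⁅a, b⁆ ∈ commIdeal L := fun a b => Submodule.subset_span ⟨a, b, rfl⟩
  have cen : ∀ a b : L, ⁅a, b⁆ ∈ centerSub L := fun a b => h2 (mem a b)
  have Jcen : ∀ a b : L, Jb ⁅a, b⁆ ∈ centerSub L :=
    fun a b => hnil (Submodule.mem_map_of_mem (mem a b))
  have right : ∀ X a b : L, obata J1 J2 J3 X ⁅a, b⁆ = 0 :=
    fun X a b => hH.obata_right_eq_zero hb (cen a b) (Jcen a b) X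
  have iter : ∀ X Y Z : L, obata J1 J2 J3 X (obata J1 J2 J3 Y Z) = 0 := by
    intro X Y Z
    rw [obata.eq_def J1 J2 J3 Y Z, obata_smul, sub_eq_add_neg]
    simp only [obata_add, obata_neg, hH.obata_J1, hH.obata_J2, hH.obata_J3, right, map_zero,
      add_zero, neg_zero, smul_zero]
  intro X Y Z
  rw [obataCurv, iter, iter, hH.obata_left_eq_zero hb (cen X Y) (Jcen X Y), sub_zero, sub_zero]
end
end

section
/- Let (𝔫, J₁, J₂, J₃) be a 2-step nilpotent hypercomplex real Lie algebra, let (I₁,I₂,I₃) be linear endomorphisms of ℝ^{4k} with I_α² = −id and I₁I₂ = −I₂I₁ = I₃, and let μ : 𝔫 × 𝔫 → ℝ^{4k} be an alternating bilinear map with μ(𝔫¹, ·) = 0. Define on 𝔤 = 𝔫 ⊕ ℝ^{4k} the bracket [X + U, Y + V]' = [X,Y] + μ(X,Y) for X, Y ∈ 𝔫, U, V ∈ ℝ^{4k}. Then [·,·]' satisfies the Jacobi identity and makes 𝔤 a 2-step nilpotent Lie algebra, and for each α the endomorphism J'_α = J_α ⊕ I_α of 𝔤 is integrable (its Nijenhuis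 tensor with respect to [·,·]' vanishes) if and only if I_α μ(X,Y) = μ(J_αX, Y) + μ(X, J_αY) + I_α μ(J_αX, J_αY) for all X, Y ∈ 𝔫. -/
noncomputable section

lemma lie_mem_commIdeal_s5 {L : Type*} [LieRing L] [LieAlgebra ℝ L] (x y : L) :
    ⁅x, y⁆ ∈ commIdeal L :=
  Submodule.subset_span ⟨x, y, rfl⟩

/-- Applying `I` with `I² = -1` to a Nijenhuis-type identity gives an equivalent identity. -/
lemma add_apply_sub_eq_zero_iff {V : Type*} [AddCommGroup V] [Module ℝ V] (I : Module.End ℝ V)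
    (hI : ∀ v, I (I v) = -v) (a b c : V) : a + I b - c = 0 ↔ I a = b + I c := by
  have hinj : Function.Injective I := fun v w h => by
    rw [← neg_inj, ← hI v, ← hI w, h]
  rw [← hinj.eq_iff, map_zero, map_sub, map_add, hI, ← sub_eq_zero (a := I a)]
  exact iff_of_eq (congrArg (· = 0) (by abel))

/-- The central-extension construction: given a 2-step nilpotent hypercomplex
Lie algebra `𝔫`, endomorphisms `I_α` of `ℝ^{4k}` satisfying the quaternion relations, and an
alternating bilinear `μ : 𝔫 × 𝔫 → ℝ^{4k}` with `μ(𝔫¹,·) = 0`, the bracket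
`[X+U, Y+V]' = [X,Y] + μ(X,Y)` on `𝔤 = 𝔫 ⊕ ℝ^{4k}` is antisymmetric, satisfies Jacobi, makes
`𝔤` 2-step nilpotent, and `J'_α = J_α ⊕ I_α` is integrable iff
`I_α μ(X,Y) = μ(J_αX,Y) + μ(X,J_αY) + I_α μ(J_αX,J_αY)`. -/
theorem stmt_5 {N : Type*} [LieRing N] [LieAlgebra ℝ N] [FiniteDimensional ℝ N] (k : ℕ)
    (J1 J2 J3 : Module.End ℝ N) (hH : IsHypercomplex J1 J2 J3)
    (h2 : commIdeal N ≤ centerSub N)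
    (I1 I2 I3 : Module.End ℝ (Fin (4*k) → ℝ))
    (hI1 : ∀ v, I1 (I1 v) = -v) (hI2 : ∀ v, I2 (I2 v) = -v) (hI3 : ∀ v, I3 (I3 v) = -v)
    (hq12 : ∀ v, I1 (I2 v) = I3 v) (hq21 : ∀ v, I2 (I1 v) = -(I3 v))
    (μ : N →ₗ[ℝ] N →ₗ[ℝ] (Fin (4*k) → ℝ))
    (halt : ∀ x : N, μ x x = 0)
    (hker : ∀ x ∈ commIdeal N, μ x = 0)
    (br : N × (Fin (4*k) → ℝ) → N × (Fin (4*k) → ℝ) → N × (Fin (4*k) → ℝ))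
    (hbr : ∀ p q, br p q = (⁅p.1, q.1⁆, μ p.1 q.1)) :
    (∀ p q, br p q = -br q p) ∧
    (∀ p q r, br p (br q r) + br q (br r p) + br r (br p q) = 0) ∧
    (∀ p q r, br (br p q) r = 0) ∧
    (∀ (J : Module.End ℝ N) (I : Module.End ℝ (Fin (4*k) → ℝ))
        (J' : N × (Fin (4*k) → ℝ) → N × (Fin (4*k) → ℝ)),
      ((J, I) = (J1, I1) ∨ (J, I) = (J2, I2) ∨ (J, I) = (J3, I3)) →
      (∀ p, J' p = (J p.1, I p.2)) →
      ((∀ p q, br p q + J' (br (J' p) q + br p (J' q)) - br (J' p) (J' q) = 0) ↔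
        (∀ x y : N, I (μ x y) = μ (J x) y + μ x (J y) + I (μ (J x) (J y))))) := by
  have hanti : ∀ x y : N, μ x y = -μ y x := fun x y => by
    have h := halt (x + y)
    simp only [map_add, LinearMap.add_apply, halt, zero_add, add_zero] at h
    exact eq_neg_of_add_eq_zero_right h
  have hbr_br : ∀ p q r, br (br p q) r = 0 := fun p q r => by
    rw [hbr, hbr]
    exact Prod.ext (h2 (lie_mem_commIdeal_s5 p.1 q.1) r.1)
      (by simp [hker _ (lie_mem_commIdeal_s5 p.1 q.1)])
  have hbr_anti : ∀ p q, br p q = -br q p := fun p q => by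
    rw [hbr, hbr]
    exact Prod.ext (lie_skew p.1 q.1).symm (hanti p.1 q.1)
  refine ⟨hbr_anti, fun p q r => ?_, hbr_br, fun J I J' hJI hJ' => ?_⟩
  · rw [hbr_anti p (br q r), hbr_anti q (br r p), hbr_anti r (br p q), hbr_br, hbr_br, hbr_br]
    simp
  · have hint : IsComplexStructure J ∧ ∀ v, I (I v) = -v := by
      rcases hJI with h | h | h <;> obtain ⟨rfl, rfl⟩ := Prod.mk.inj h
      exacts [⟨hH.c1, hI1⟩, ⟨hH.c2, hI2⟩, ⟨hH.c3, hI3⟩]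
    obtain ⟨hJ, hI⟩ := hint
    have hcomp : ∀ p q, br p q + J' (br (J' p) q + br p (J' q)) - br (J' p) (J' q) =
        (nijenhuis J p.1 q.1,
          μ p.1 q.1 + I (μ (J p.1) q.1 + μ p.1 (J q.1)) - μ (J p.1) (J q.1)) := fun p q => by
      simp only [hbr, hJ', nijenhuis, Prod.mk_add_mk, Prod.mk_sub_mk]
    simp only [hcomp, hJ.integrable, Prod.mk_eq_zero, true_and,
      add_apply_sub_eq_zero_iff I hI]
    exact ⟨fun h x y => h (x, 0) (y, 0), fun h p q => h p.1 q.1⟩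
end
end

section
/- Let (𝔤, J₁, J₂, J₃) be a nilpotent hypercomplex real Lie algebra. Then for every k ≥ 1 the subspace 𝔤_k^ℍ is a Lie subalgebra of 𝔤 (i.e. [𝔤_k^ℍ, 𝔤_k^ℍ] ⊆ 𝔤_k^ℍ) and it is an ideal in 𝔤_{k−1}^ℍ (i.e. [𝔤_k^ℍ, 𝔤_{k−1}^ℍ] ⊆ 𝔤_k^ℍ). -/
noncomputable section

/-- The lower central series of a (possibly non-associative) bracket on a module:
`lcsBr br 0 = ⊤`, `lcsBr br (j+1) = span {br x y : y ∈ lcsBr br j}`. -/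
def lcsBr {M : Type*} [AddCommGroup M] [Module ℝ M] (br : M → M → M) : ℕ → Submodule ℝ M
  | 0 => ⊤
  | (j + 1) => Submodule.span ℝ {z : M | ∃ x : M, ∃ y ∈ lcsBr br j, br x y = z}

/-- The `ℍ`-series `𝔤_k^ℍ`: `𝔤₀^ℍ = 𝔤` and
`𝔤_k^ℍ = [𝔤_{k-1}^ℍ,𝔤_{k-1}^ℍ] + J₁[⋯] + J₂[⋯] + J₃[⋯]`. -/
def gH {L : Type*} [LieRing L] [LieAlgebra ℝ L] (J1 J2 J3 : Module.End ℝ L) :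
    ℕ → Submodule ℝ L
  | 0 => ⊤
  | (k + 1) =>
      let B := Submodule.span ℝ
        {z : L | ∃ x ∈ gH J1 J2 J3 k, ∃ y ∈ gH J1 J2 J3 k, ⁅x, y⁆ = z}
      B ⊔ B.map J1 ⊔ B.map J2 ⊔ B.map J3

theorem lie_mem_gH_succ {L : Type*} [LieRing L] [LieAlgebra ℝ L] (J1 J2 J3 : Module.End ℝ L)
    {k : ℕ} {x y : L} (hx : x ∈ gH J1 J2 J3 k) (hy : y ∈ gH J1 J2 J3 k) :
    ⁅x, y⁆ ∈ gH J1 J2 J3 (k + 1) := by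
  rw [gH]
  exact Submodule.mem_sup_left (Submodule.mem_sup_left (Submodule.mem_sup_left
    (Submodule.subset_span ⟨x, hx, y, hy, rfl⟩)))

theorem gH_succ_le {L : Type*} [LieRing L] [LieAlgebra ℝ L] (J1 J2 J3 : Module.End ℝ L)
    (k : ℕ) : gH J1 J2 J3 (k + 1) ≤ gH J1 J2 J3 k := by
  induction k with
  | zero => exact le_top
  | succ k ih =>
    have hB : Submodule.span ℝ
          {z : L | ∃ x ∈ gH J1 J2 J3 (k + 1), ∃ y ∈ gH J1 J2 J3 (k + 1), ⁅x, y⁆ = z} ≤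
        Submodule.span ℝ {z : L | ∃ x ∈ gH J1 J2 J3 k, ∃ y ∈ gH J1 J2 J3 k, ⁅x, y⁆ = z} :=
      Submodule.span_mono fun z ⟨x, hx, y, hy, h⟩ => ⟨x, ih hx, y, ih hy, h⟩
    rw [gH, gH]
    exact sup_le_sup (sup_le_sup (sup_le_sup hB (Submodule.map_mono hB))
      (Submodule.map_mono hB)) (Submodule.map_mono hB)

/-- For a nilpotent hypercomplex Lie algebra, each `𝔤_k^ℍ` (`k ≥ 1`) is a Lie
subalgebra of `𝔤` and an ideal in `𝔤_{k-1}^ℍ`. -/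
theorem stmt_11 {L : Type*} [LieRing L] [LieAlgebra ℝ L] [FiniteDimensional ℝ L]
    (J1 J2 J3 : Module.End ℝ L) (hH : IsHypercomplex J1 J2 J3)
    (hnilp : ∃ n : ℕ, lcsBr (fun x y : L => ⁅x, y⁆) n = ⊥) :
    ∀ k : ℕ, 1 ≤ k →
      (∀ a ∈ gH J1 J2 J3 k, ∀ b ∈ gH J1 J2 J3 k, ⁅a, b⁆ ∈ gH J1 J2 J3 k) ∧
      (∀ a ∈ gH J1 J2 J3 k, ∀ b ∈ gH J1 J2 J3 (k - 1), ⁅a, b⁆ ∈ gH J1 J2 J3 k) := by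
  intro k hk
  obtain ⟨m, rfl⟩ : ∃ m, k = m + 1 := ⟨k - 1, by omega⟩
  have hle := gH_succ_le J1 J2 J3 m
  exact ⟨fun a ha b hb => lie_mem_gH_succ J1 J2 J3 (hle ha) (hle hb),
    fun a ha b hb => lie_mem_gH_succ J1 J2 J3 (hle ha) hb⟩
end
end

section
/- Let (𝔤, J₁, J₂, J₃) be a 2-step nilpotent hypercomplex real Lie algebra. Then J₁[J₂𝔤¹, J₃𝔤¹] = J₂[J₁𝔤¹, J₃𝔤¹] = J₃[J₁𝔤¹, J₂𝔤¹], where for subspaces A, B ⊆ 𝔤, [A,B] denotes the span of all brackets [a,b] with a ∈ A, b ∈ B. -/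
noncomputable section

/-- The span of all brackets `⁅a, b⁆` with `a ∈ A`, `b ∈ B`. -/
def bracketSpan {L : Type*} [LieRing L] [LieAlgebra ℝ L] (A B : Submodule ℝ L) :
    Submodule ℝ L :=
  Submodule.span ℝ {z : L | ∃ a ∈ A, ∃ b ∈ B, ⁅a, b⁆ = z}

/-- For a central element `a`, the integrability of `J` reads `[Ja, JY] = J[Ja, Y]`. -/
theorem IsComplexStructure.lie_map_map {L : Type*} [LieRing L] [LieAlgebra ℝ L]
    {J : Module.End ℝ L} (hJ : IsComplexStructure J) {a : L} (ha : a ∈ centerSub L) (Y : L) :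
    ⁅J a, J Y⁆ = J ⁅J a, Y⁆ := by
  have ha' : ∀ x : L, ⁅a, x⁆ = 0 := ha
  have h := hJ.integrable a Y
  simp only [nijenhuis, ha', zero_add, add_zero] at h
  exact (sub_eq_zero.mp h).symm

theorem IsHypercomplex.q23_s13 {L : Type*} [LieRing L] [LieAlgebra ℝ L]
    {J1 J2 J3 : Module.End ℝ L} (hH : IsHypercomplex J1 J2 J3) (X : L) :
    J2 (J3 X) = J1 X := by
  rw [← hH.q12, hH.q21, ← hH.q12, hH.c2.sq, map_neg, neg_neg]

theorem IsHypercomplex.q32 {L : Type*} [LieRing L] [LieAlgebra ℝ L]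
    {J1 J2 J3 : Module.End ℝ L} (hH : IsHypercomplex J1 J2 J3) (X : L) :
    J3 (J2 X) = -J1 X := by
  rw [← hH.q12, hH.c2.sq, map_neg]

/-- `J₃[J₁a, J₂b] = J₁[J₂b, J₃a]` for central `b`. -/
theorem IsHypercomplex.map_three_lie {L : Type*} [LieRing L] [LieAlgebra ℝ L]
    {J1 J2 J3 : Module.End ℝ L} (hH : IsHypercomplex J1 J2 J3)
    (a : L) {b : L} (hb : b ∈ centerSub L) :
    J3 ⁅J1 a, J2 b⁆ = J1 ⁅J2 b, J3 a⁆ := by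
  rw [← hH.q12, ← lie_skew, map_neg, ← hH.c2.lie_map_map hb, hH.q21, lie_neg, neg_neg]

/-- `J₁[J₂a, J₃b] = -J₂[J₁a, J₃b]` for central `b`. -/
theorem IsHypercomplex.map_one_lie {L : Type*} [LieRing L] [LieAlgebra ℝ L]
    {J1 J2 J3 : Module.End ℝ L} (hH : IsHypercomplex J1 J2 J3)
    (a : L) {b : L} (hb : b ∈ centerSub L) :
    J1 ⁅J2 a, J3 b⁆ = -J2 ⁅J1 a, J3 b⁆ := by
  rw [← hH.q23_s13, ← lie_skew, map_neg, ← hH.c3.lie_map_map hb, hH.q32, lie_neg, neg_neg,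
    ← lie_skew, map_neg]

/-- Comparison of two images of bracket spans on generators. -/
theorem map_bracketSpan_le {L : Type*} [LieRing L] [LieAlgebra ℝ L] {G : Submodule ℝ L}
    {J P Q J' P' Q' : Module.End ℝ L}
    (h : ∀ a ∈ G, ∀ b ∈ G, ∃ c ∈ G, ∃ d ∈ G, J ⁅P a, Q b⁆ = J' ⁅P' c, Q' d⁆) :
    (bracketSpan (G.map P) (G.map Q)).map J ≤ (bracketSpan (G.map P') (G.map Q')).map J' := by
  rw [Submodule.map_le_iff_le_comap, bracketSpan, Submodule.span_le]
  rintro _ ⟨_, ⟨a, ha, rfl⟩, _, ⟨b, hb, rfl⟩, rfl⟩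
  obtain ⟨c, hc, d, hd, hcd⟩ := h a ha b hb
  exact ⟨⁅P' c, Q' d⁆, Submodule.subset_span ⟨_, ⟨c, hc, rfl⟩, _, ⟨d, hd, rfl⟩, rfl⟩, hcd.symm⟩

/-- In a 2-step nilpotent hypercomplex Lie algebra,
`J₁[J₂𝔤¹, J₃𝔤¹] = J₂[J₁𝔤¹, J₃𝔤¹] = J₃[J₁𝔤¹, J₂𝔤¹]`. -/
theorem stmt_13 {L : Type*} [LieRing L] [LieAlgebra ℝ L] [FiniteDimensional ℝ L]
    (J1 J2 J3 : Module.End ℝ L) (hH : IsHypercomplex J1 J2 J3)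
    (h2 : commIdeal L ≤ centerSub L) :
    (bracketSpan ((commIdeal L).map J2) ((commIdeal L).map J3)).map J1 =
      (bracketSpan ((commIdeal L).map J1) ((commIdeal L).map J3)).map J2 ∧
    (bracketSpan ((commIdeal L).map J1) ((commIdeal L).map J3)).map J2 =
      (bracketSpan ((commIdeal L).map J1) ((commIdeal L).map J2)).map J3 := by
  have h12 : (bracketSpan ((commIdeal L).map J2) ((commIdeal L).map J3)).map J1 ≤
      (bracketSpan ((commIdeal L).map J1) ((commIdeal L).map J3)).map J2 :=
    map_bracketSpan_le fun a ha b hb => ⟨-a, neg_mem ha, b, hb, by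
      rw [hH.map_one_lie a (h2 hb), map_neg, neg_lie, map_neg]⟩
  have h23 : (bracketSpan ((commIdeal L).map J1) ((commIdeal L).map J3)).map J2 ≤
      (bracketSpan ((commIdeal L).map J1) ((commIdeal L).map J2)).map J3 :=
    map_bracketSpan_le fun a ha b hb => ⟨-b, neg_mem hb, a, ha, by
      rw [hH.map_three_lie (-b) (h2 ha), map_neg, lie_neg, map_neg,
        hH.map_one_lie a (h2 hb), neg_neg]⟩
  have h31 : (bracketSpan ((commIdeal L).map J1) ((commIdeal L).map J2)).map J3 ≤
      (bracketSpan ((commIdeal L).map J2) ((commIdeal L).map J3)).map J1 :=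
    map_bracketSpan_le fun a ha b hb => ⟨b, hb, a, ha, hH.map_three_lie a (h2 hb)⟩
  exact ⟨h12.antisymm (h23.trans h31), h23.antisymm (h31.trans h12)⟩
end
end

section
/- Let (𝔤, J₁, J₂, J₃) be a 2-step nilpotent hypercomplex real Lie algebra and set 𝔥 = (𝔤¹ ∩ J₂𝔤¹) + (J₁𝔤¹ ∩ J₃𝔤¹). Then for every X ∈ 𝔥 and every Y ∈ 𝔤 one has [Y,X] + J₁[J₁Y, X] = 0. -/
noncomputable section

/-- The subspace `𝔥 = (𝔤¹ ∩ J₂𝔤¹) + (J₁𝔤¹ ∩ J₃𝔤¹)`. -/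
def hSub {L : Type*} [LieRing L] [LieAlgebra ℝ L] (J1 J2 J3 : Module.End ℝ L) :
    Submodule ℝ L :=
  (commIdeal L ⊓ (commIdeal L).map J2) ⊔ ((commIdeal L).map J1 ⊓ (commIdeal L).map J3)

/-- If `J` is a complex structure and `A` is central, then `[JY, JA] = J[Y, JA]`. -/
theorem IsComplexStructure.lie_apply_of_mem_centerSub {L : Type*} [LieRing L] [LieAlgebra ℝ L]
    {J : Module.End ℝ L} (hJ : IsComplexStructure J) {A : L} (hA : A ∈ centerSub L) (Y : L) :
    ⁅J Y, J A⁆ = J ⁅Y, J A⁆ := by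
  have hc : ∀ Z : L, ⁅Z, A⁆ = 0 := fun Z => by
    rw [← lie_skew, show ⁅A, Z⁆ = 0 from hA Z, neg_zero]
  have h := hJ.integrable Y A
  rw [nijenhuis, hc, hc, zero_add, zero_add] at h
  exact (sub_eq_zero.mp h).symm

/-- In a 2-step nilpotent hypercomplex Lie algebra, for every
`X ∈ 𝔥 = (𝔤¹ ∩ J₂𝔤¹) + (J₁𝔤¹ ∩ J₃𝔤¹)` and every `Y ∈ 𝔤` one has `[Y,X] + J₁[J₁Y,X] = 0`. -/
theorem stmt_15 {L : Type*} [LieRing L] [LieAlgebra ℝ L] [FiniteDimensional ℝ L]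
    (J1 J2 J3 : Module.End ℝ L) (hH : IsHypercomplex J1 J2 J3)
    (h2 : commIdeal L ≤ centerSub L) :
    ∀ X ∈ hSub J1 J2 J3, ∀ Y : L, ⁅Y, X⁆ + J1 ⁅J1 Y, X⁆ = 0 := by
  intro X hX Y
  obtain ⟨U, hU, V, hV, rfl⟩ := Submodule.mem_sup.mp hX
  obtain ⟨A, hA, rfl⟩ := Submodule.mem_map.mp hV.1
  have hc : ∀ Z : L, ⁅Z, U⁆ = 0 := fun Z => by
    rw [← lie_skew, show ⁅U, Z⁆ = 0 from h2 hU.1 Z, neg_zero]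
  rw [lie_add, lie_add, hc, hc, zero_add, zero_add,
    hH.c1.lie_apply_of_mem_centerSub (h2 hA), hH.c1.sq, add_neg_cancel]
end
end

section
/- Let (𝔤, J₁, J₂, J₃) be a 2-step nilpotent hypercomplex real Lie algebra with Obata connection ∇ and curvature R. Let 𝒜 be the smallest linear subspace of End(𝔤) that contains R(X,Y) for all X, Y ∈ 𝔤 and satisfies ∇_X ∘ A − A ∘ ∇_X ∈ 𝒜 for all A ∈ 𝒜 and X ∈ 𝔤 (by the Ambrose–Singer theorem for left-invariant connections, 𝒜 is the holonomy algebra of the Obata connection of the corresponding simply connected Lie group). Then A ∘ B = 0 for all A, B ∈ 𝒜; in particular 𝒜 is an abelian Lie subalgebra of End(𝔤), every A ∈ 𝒜 satisfies A² = 0, and every A ∈ 𝒜 has trace zero. -/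
noncomputable section

/-- The Obata connection `∇_X` as an endomorphism of `𝔤`. -/
def obataEnd {L : Type*} [LieRing L] [LieAlgebra ℝ L] (J1 J2 J3 : Module.End ℝ L)
    (X : L) : Module.End ℝ L :=
  (1/2 : ℝ) • (LieAlgebra.ad ℝ L X + J1 * LieAlgebra.ad ℝ L (J1 X)
    - J2 * LieAlgebra.ad ℝ L X * J2 + J3 * LieAlgebra.ad ℝ L (J1 X) * J2)

/-- The curvature endomorphism `R(X,Y)` of the Obata connection. -/
def obataCurvEnd {L : Type*} [LieRing L] [LieAlgebra ℝ L] (J1 J2 J3 : Module.End ℝ L)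
    (X Y : L) : Module.End ℝ L :=
  obataEnd J1 J2 J3 X * obataEnd J1 J2 J3 Y - obataEnd J1 J2 J3 Y * obataEnd J1 J2 J3 X
    - obataEnd J1 J2 J3 ⁅X, Y⁆

section ObataTwoStep

variable {L : Type*} [LieRing L] [LieAlgebra ℝ L] {J1 J2 J3 : Module.End ℝ L}

theorem lie_mem_centerSub (h2 : commIdeal L ≤ centerSub L) (X Y : L) :
    ⁅X, Y⁆ ∈ centerSub L :=
  h2 (Submodule.subset_span ⟨X, Y, rfl⟩)

theorem lie_eq_zero_of_mem_centerSub {Z : L} (hZ : Z ∈ centerSub L) (X : L) : ⁅X, Z⁆ = 0 := by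
  rw [← lie_skew, hZ X, neg_zero]

/-- If `Z` is central and `J` is integrable, then `J[X,JZ] = [JX,JZ]`. -/
theorem IsComplexStructure.map_lie_of_mem_centerSub {J : Module.End ℝ L}
    (hJ : IsComplexStructure J) {Z : L} (hZ : Z ∈ centerSub L) (X : L) :
    J ⁅X, J Z⁆ = ⁅J X, J Z⁆ := by
  have h := hJ.integrable X Z
  rw [nijenhuis, lie_eq_zero_of_mem_centerSub hZ, lie_eq_zero_of_mem_centerSub hZ,
    zero_add, zero_add] at h
  exact sub_eq_zero.1 h

theorem obataEnd_apply (J1 J2 J3 : Module.End ℝ L) (X Y : L) :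
    obataEnd J1 J2 J3 X Y =
      (1/2 : ℝ) • (⁅X, Y⁆ + J1 ⁅J1 X, Y⁆ - J2 ⁅X, J2 Y⁆ + J3 ⁅J1 X, J2 Y⁆) := by
  simp [obataEnd]

theorem IsHypercomplex.J2_J1 (hH : IsHypercomplex J1 J2 J3) (X : L) :
    J2 (J1 X) = -J1 (J2 X) := by
  rw [hH.q21, hH.q12]

theorem IsHypercomplex.obataEnd_map_J2 (hH : IsHypercomplex J1 J2 J3) (X Y : L) :
    obataEnd J1 J2 J3 X (J2 Y) = J2 (obataEnd J1 J2 J3 X Y) := by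
  simp only [obataEnd_apply, map_smul, map_add, map_sub, hH.c2.sq, lie_neg, map_neg, hH.J2_J1,
    ← hH.q12]
  congr 1
  abel

theorem IsHypercomplex.obataEnd_map_J1 (hH : IsHypercomplex J1 J2 J3) (X Y : L) :
    obataEnd J1 J2 J3 X (J1 Y) = J1 (obataEnd J1 J2 J3 X Y) := by
  have h1 := congrArg J1 (hH.c1.integrable X Y)
  have h2 := congrArg (fun v => J1 (J2 v)) (hH.c1.integrable X (J2 Y))
  simp only [nijenhuis, map_add, map_sub, map_neg, map_zero, hH.c1.sq, hH.J2_J1] at h1 h2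
  simp only [obataEnd_apply, map_smul, map_add, map_sub, hH.c1.sq, lie_neg, map_neg, hH.J2_J1,
    ← hH.q12]
  congr 1
  rw [← sub_eq_zero, ← sub_eq_zero.2 (h2.trans h1.symm)]
  abel

theorem IsHypercomplex.obataEnd_map_J3 (hH : IsHypercomplex J1 J2 J3) (X Y : L) :
    obataEnd J1 J2 J3 X (J3 Y) = J3 (obataEnd J1 J2 J3 X Y) := by
  rw [← hH.q12, hH.obataEnd_map_J1, hH.obataEnd_map_J2, hH.q12]

theorem obataEnd_eq_zero_of_J2_mem {c : L}
    (hc : c ∈ centerSub L) (hc2 : J2 c ∈ centerSub L) (X : L) :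
    obataEnd J1 J2 J3 X c = 0 := by
  simp [obataEnd_apply, lie_eq_zero_of_mem_centerSub hc, lie_eq_zero_of_mem_centerSub hc2]

theorem IsHypercomplex.obataEnd_eq_zero_of_J1_mem (hH : IsHypercomplex J1 J2 J3) {c : L}
    (hc : c ∈ centerSub L) (hc1 : J1 c ∈ centerSub L) (X : L) :
    obataEnd J1 J2 J3 X c = 0 := by
  have e : J2 c = J3 (J1 c) := by
    rw [← hH.q12, hH.q21, map_neg, ← hH.q12, hH.c1.sq, neg_neg]
  have e' : J3 (J1 X) = J2 X := by
    rw [← hH.q12, hH.q21, map_neg, ← hH.q12, hH.c1.sq, neg_neg]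
  have h : J3 ⁅J1 X, J2 c⁆ = J2 ⁅X, J2 c⁆ := by
    rw [hH.c2.map_lie_of_mem_centerSub hc, e, hH.c3.map_lie_of_mem_centerSub hc1, e']
  simp [obataEnd_apply, lie_eq_zero_of_mem_centerSub hc, h]

/-- The subspace of left-invariant Obata-parallel vectors. -/
def obataKernel (J1 J2 J3 : Module.End ℝ L) : Submodule ℝ L :=
  ⨅ X : L, LinearMap.ker (obataEnd J1 J2 J3 X)

theorem mem_obataKernel {v : L} :
    v ∈ obataKernel J1 J2 J3 ↔ ∀ X : L, obataEnd J1 J2 J3 X v = 0 := by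
  simp [obataKernel]

theorem IsHypercomplex.map_J1_mem_obataKernel (hH : IsHypercomplex J1 J2 J3) {v : L}
    (hv : v ∈ obataKernel J1 J2 J3) : J1 v ∈ obataKernel J1 J2 J3 :=
  mem_obataKernel.2 fun X => by rw [hH.obataEnd_map_J1, mem_obataKernel.1 hv, map_zero]

theorem IsHypercomplex.map_J2_mem_obataKernel (hH : IsHypercomplex J1 J2 J3) {v : L}
    (hv : v ∈ obataKernel J1 J2 J3) : J2 v ∈ obataKernel J1 J2 J3 :=
  mem_obataKernel.2 fun X => by rw [hH.obataEnd_map_J2, mem_obataKernel.1 hv, map_zero]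

theorem IsHypercomplex.map_J3_mem_obataKernel (hH : IsHypercomplex J1 J2 J3) {v : L}
    (hv : v ∈ obataKernel J1 J2 J3) : J3 v ∈ obataKernel J1 J2 J3 := by
  rw [← hH.q12]
  exact hH.map_J1_mem_obataKernel (hH.map_J2_mem_obataKernel hv)

theorem IsHypercomplex.lie_J2_mem_obataKernel (hH : IsHypercomplex J1 J2 J3)
    (h2 : commIdeal L ≤ centerSub L) {Z : L} (hZ : Z ∈ centerSub L) (X : L) :
    ⁅X, J2 Z⁆ ∈ obataKernel J1 J2 J3 :=
  mem_obataKernel.2 <| obataEnd_eq_zero_of_J2_mem (lie_mem_centerSub h2 _ _) <| by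
    rw [hH.c2.map_lie_of_mem_centerSub hZ]
    exact lie_mem_centerSub h2 _ _

theorem IsHypercomplex.lie_J1_mem_obataKernel (hH : IsHypercomplex J1 J2 J3)
    (h2 : commIdeal L ≤ centerSub L) {Z : L} (hZ : Z ∈ centerSub L) (X : L) :
    ⁅X, J1 Z⁆ ∈ obataKernel J1 J2 J3 :=
  mem_obataKernel.2 <| hH.obataEnd_eq_zero_of_J1_mem (lie_mem_centerSub h2 _ _) <| by
    rw [hH.c1.map_lie_of_mem_centerSub hZ]
    exact lie_mem_centerSub h2 _ _

theorem IsHypercomplex.obataEnd_apply_center_mem (hH : IsHypercomplex J1 J2 J3)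
    (h2 : commIdeal L ≤ centerSub L) {Z : L} (hZ : Z ∈ centerSub L) (X : L) :
    obataEnd J1 J2 J3 X Z ∈ obataKernel J1 J2 J3 := by
  rw [obataEnd_apply, lie_eq_zero_of_mem_centerSub hZ, lie_eq_zero_of_mem_centerSub hZ,
    map_zero, add_zero, zero_sub]
  exact Submodule.smul_mem _ _ (add_mem
    (neg_mem (hH.map_J2_mem_obataKernel (hH.lie_J2_mem_obataKernel h2 hZ X)))
    (hH.map_J3_mem_obataKernel (hH.lie_J2_mem_obataKernel h2 hZ _)))

theorem IsHypercomplex.obataEnd_center_apply_mem (hH : IsHypercomplex J1 J2 J3)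
    (h2 : commIdeal L ≤ centerSub L) {Z : L} (hZ : Z ∈ centerSub L) (X : L) :
    obataEnd J1 J2 J3 Z X ∈ obataKernel J1 J2 J3 := by
  rw [obataEnd_apply, hZ, hZ, map_zero, zero_add, sub_zero, ← lie_skew, ← lie_skew _ (J2 X)]
  exact Submodule.smul_mem _ _ (add_mem
    (hH.map_J1_mem_obataKernel (neg_mem (hH.lie_J1_mem_obataKernel h2 hZ X)))
    (hH.map_J3_mem_obataKernel (neg_mem (hH.lie_J1_mem_obataKernel h2 hZ _))))

theorem IsHypercomplex.obataEnd_obataEnd_mem (hH : IsHypercomplex J1 J2 J3)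
    (h2 : commIdeal L ≤ centerSub L) (X Y V : L) :
    obataEnd J1 J2 J3 X (obataEnd J1 J2 J3 Y V) ∈ obataKernel J1 J2 J3 := by
  have h := fun U W : L => hH.obataEnd_apply_center_mem h2 (lie_mem_centerSub h2 U W) X
  rw [obataEnd_apply J1 J2 J3 Y V, map_smul, map_add, map_sub, map_add, hH.obataEnd_map_J1,
    hH.obataEnd_map_J2, hH.obataEnd_map_J3]
  exact Submodule.smul_mem _ _ (add_mem (sub_mem (add_mem (h _ _)
    (hH.map_J1_mem_obataKernel (h _ _))) (hH.map_J2_mem_obataKernel (h _ _)))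
    (hH.map_J3_mem_obataKernel (h _ _)))

/-- The endomorphisms that vanish on `K` and have image in `K`. -/
def squareZeroEnd (K : Submodule ℝ L) : Submodule ℝ (Module.End ℝ L) where
  carrier := {a | (∀ v, a v ∈ K) ∧ ∀ v ∈ K, a v = 0}
  add_mem' ha hb :=
    ⟨fun v => add_mem (ha.1 v) (hb.1 v), fun v hv => by
      rw [LinearMap.add_apply, ha.2 v hv, hb.2 v hv, add_zero]⟩
  zero_mem' := ⟨fun _ => K.zero_mem, fun _ _ => rfl⟩
  smul_mem' c _ ha :=
    ⟨fun v => K.smul_mem c (ha.1 v), fun v hv => by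
      rw [LinearMap.smul_apply, ha.2 v hv, smul_zero]⟩

theorem mul_eq_zero_of_mem_squareZeroEnd {K : Submodule ℝ L} {a b : Module.End ℝ L}
    (ha : a ∈ squareZeroEnd K) (hb : b ∈ squareZeroEnd K) : a * b = 0 :=
  LinearMap.ext fun v => ha.2 _ (hb.1 v)

theorem IsHypercomplex.obataCurvEnd_mem (hH : IsHypercomplex J1 J2 J3)
    (h2 : commIdeal L ≤ centerSub L) (X Y : L) :
    obataCurvEnd J1 J2 J3 X Y ∈ squareZeroEnd (obataKernel J1 J2 J3) := by
  refine ⟨fun v => ?_, fun v hv => ?_⟩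
  · exact sub_mem (sub_mem (hH.obataEnd_obataEnd_mem h2 X Y v) (hH.obataEnd_obataEnd_mem h2 Y X v))
      (hH.obataEnd_center_apply_mem h2 (lie_mem_centerSub h2 X Y) v)
  · simp [obataCurvEnd, mem_obataKernel.1 hv]

theorem obataEnd_commutator_mem {a : Module.End ℝ L}
    (ha : a ∈ squareZeroEnd (obataKernel J1 J2 J3)) (X : L) :
    obataEnd J1 J2 J3 X * a - a * obataEnd J1 J2 J3 X
      ∈ squareZeroEnd (obataKernel J1 J2 J3) := by
  refine ⟨fun v => ?_, fun v hv => ?_⟩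
  · simpa [mem_obataKernel.1 (ha.1 v)] using ha.1 _
  · simp [mem_obataKernel.1 hv, ha.2 v hv]

end ObataTwoStep

/-- For a 2-step nilpotent hypercomplex Lie algebra, let `𝒜` be the smallest
linear subspace of `End(𝔤)` containing all curvature endomorphisms `R(X,Y)` and closed under
`A ↦ ∇_X ∘ A − A ∘ ∇_X` (the holonomy algebra, by Ambrose–Singer). Then `A ∘ B = 0` for all
`A, B ∈ 𝒜`; in particular `𝒜` is abelian, `A² = 0`, and every `A ∈ 𝒜` is traceless. -/
theorem stmt_18 {L : Type*} [LieRing L] [LieAlgebra ℝ L] [FiniteDimensional ℝ L]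
    (J1 J2 J3 : Module.End ℝ L) (hH : IsHypercomplex J1 J2 J3)
    (h2 : commIdeal L ≤ centerSub L)
    (A : Submodule ℝ (Module.End ℝ L))
    (hcurv : ∀ X Y : L, obataCurvEnd J1 J2 J3 X Y ∈ A)
    (hclosed : ∀ a ∈ A, ∀ X : L,
      obataEnd J1 J2 J3 X * a - a * obataEnd J1 J2 J3 X ∈ A)
    (hmin : ∀ S : Submodule ℝ (Module.End ℝ L),
      (∀ X Y : L, obataCurvEnd J1 J2 J3 X Y ∈ S) →
      (∀ a ∈ S, ∀ X : L, obataEnd J1 J2 J3 X * a - a * obataEnd J1 J2 J3 X ∈ S) →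
      A ≤ S) :
    (∀ a ∈ A, ∀ b ∈ A, a * b = 0) ∧
    (∀ a ∈ A, ∀ b ∈ A, ⁅a, b⁆ = 0) ∧
    (∀ a ∈ A, a * a = 0) ∧
    (∀ a ∈ A, LinearMap.trace ℝ L a = 0) := by
  have hle : A ≤ squareZeroEnd (obataKernel J1 J2 J3) :=
    hmin _ (hH.obataCurvEnd_mem h2) fun a ha X => obataEnd_commutator_mem ha X
  have hmul : ∀ a ∈ A, ∀ b ∈ A, a * b = 0 := fun a ha b hb =>
    mul_eq_zero_of_mem_squareZeroEnd (hle ha) (hle hb)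
  refine ⟨hmul, fun a ha b hb => ?_, fun a ha => hmul a ha a ha, fun a ha => ?_⟩
  · rw [Ring.lie_def, hmul a ha b hb, hmul b hb a ha, sub_zero]
  · exact (LinearMap.isNilpotent_trace_of_isNilpotent
      ⟨2, by rw [pow_two, hmul a ha a ha]⟩).eq_zero
end
end
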